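/- Let π : B → C be a surjective morphism of weak Hopf *-algebras, assume B is linearly spanned by the matrix coefficients of its right unitary corepresentations, and let Λ ⊆ Ĉ be the space of left integrals on C, i.e. {φ ∈ Ĉ : (id⊗φ)Δ_C = (ε_t^C ⊗ φ)Δ_C}. Then the quotient type coideal I(π) := { b ∈ B : (π ⊗ id)Δ(b) = (π ⊗ id)((1 ⊗ b)Δ(1)) } equals the linear span of the matrix coefficients U_{ζ,η}, where U runs over the right unitary corepresentations of B on finite-dimensional Hilbert spaces H, η ∈ H, and ζ ∈ π_*(Λ)·H (where π_* : Ĉ → B̂ is the transpose of π and B̂ acts on H by ψ·ζ := ⟨ψ, U^{(2)}⟩U^{(1)}ζ). -/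

import Mathlib

open scoped TensorProduct
open TensorProduct

noncomputable section

/-- The conjugate-linear "star" operation on a tensor product of two star modules,
defined via a choice of bases so that `star (x ⊗ y) = star x ⊗ star y`. -/
def tensorStar (M N : Type) [AddCommGroup M] [Module ℂ M] [Module.Finite ℂ M]
    [Module.Free ℂ M] [StarAddMonoid M] [AddCommGroup N] [Module ℂ N] [Module.Finite ℂ N]
    [Module.Free ℂ N] [StarAddMonoid N] (t : M ⊗[ℂ] N) : M ⊗[ℂ] N :=
  let bM := Module.Free.chooseBasis ℂ M
  let bN := Module.Free.chooseBasis ℂ N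
  ∑ p : Module.Free.ChooseBasisIndex ℂ M × Module.Free.ChooseBasisIndex ℂ N,
    (starRingEnd ℂ) (((bM.tensorProduct bN).repr t) p) • (star (bM p.1) ⊗ₜ[ℂ] star (bN p.2))

/-- A weak Hopf `*`-algebra structure on a finite-dimensional `C*`-algebra `B`. -/
structure WHA (B : Type) [NormedRing B] [StarRing B] [CStarRing B] [NormedAlgebra ℂ B]
    [StarModule ℂ B] [FiniteDimensional ℂ B] where
  Δ : B →ₗ[ℂ] B ⊗[ℂ] B
  ε : B →ₗ[ℂ] ℂ
  S : B →ₗ[ℂ] B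
  coassoc : ∀ b : B, (TensorProduct.assoc ℂ B B B) ((TensorProduct.map Δ LinearMap.id) (Δ b)) =
    (TensorProduct.map LinearMap.id Δ) (Δ b)
  counit_left : ∀ b : B, (TensorProduct.lid ℂ B) ((TensorProduct.map ε LinearMap.id) (Δ b)) = b
  counit_right : ∀ b : B, (TensorProduct.rid ℂ B) ((TensorProduct.map LinearMap.id ε) (Δ b)) = b
  comul_mul : ∀ a b : B, Δ (a * b) = Δ a * Δ b
  weak_counit : ∀ b c d : B, (TensorProduct.lid ℂ ℂ)
      ((TensorProduct.map (ε ∘ₗ LinearMap.mulLeft ℂ b) (ε ∘ₗ LinearMap.mulRight ℂ d)) (Δ c)) =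
    ε (b * c * d)
  weak_comul_one : (TensorProduct.map Δ LinearMap.id) (Δ 1) =
    (Δ 1 ⊗ₜ[ℂ] (1 : B)) * ((TensorProduct.assoc ℂ B B B).symm ((1 : B) ⊗ₜ[ℂ] Δ 1))
  comul_star : ∀ b : B, Δ (star b) = tensorStar B B (Δ b)
  antipode_mul : ∀ a b : B, S (a * b) = S b * S a
  antipode_one : S 1 = 1
  antipode_comul : ∀ b : B, Δ (S b) =
    (TensorProduct.map S S) ((TensorProduct.comm ℂ B B) (Δ b))
  counit_antipode : ∀ b : B, ε (S b) = ε b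
  antipode_left : ∀ b : B, LinearMap.mul' ℂ B ((TensorProduct.map LinearMap.id S) (Δ b)) =
    (TensorProduct.lid ℂ B) ((TensorProduct.map ε LinearMap.id) (Δ 1 * (b ⊗ₜ[ℂ] (1 : B))))
  antipode_right : ∀ b : B, LinearMap.mul' ℂ B ((TensorProduct.map S LinearMap.id) (Δ b)) =
    (TensorProduct.rid ℂ B) ((TensorProduct.map LinearMap.id ε) (((1 : B) ⊗ₜ[ℂ] b) * Δ 1))

namespace WHA

variable {B : Type} [NormedRing B] [StarRing B] [CStarRing B] [NormedAlgebra ℂ B]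
  [StarModule ℂ B] [FiniteDimensional ℂ B]

/-- The target counital map `ε_t(b) = (ε ⊗ id)(Δ(1)(b ⊗ 1))`. -/
def εt (W : WHA B) (b : B) : B :=
  (TensorProduct.lid ℂ B) ((TensorProduct.map W.ε LinearMap.id) (W.Δ 1 * (b ⊗ₜ[ℂ] (1 : B))))

/-- The source counital map `ε_s(b) = (id ⊗ ε)((1 ⊗ b)Δ(1))`. -/
def εs (W : WHA B) (b : B) : B :=
  (TensorProduct.rid ℂ B) ((TensorProduct.map LinearMap.id W.ε) (((1 : B) ⊗ₜ[ℂ] b) * W.Δ 1))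

/-- The target counital subalgebra `B_t = ε_t(B)`. -/
def Bt (W : WHA B) : Submodule ℂ B := Submodule.span ℂ (Set.range W.εt)

/-- The source counital subalgebra `B_s = ε_s(B)`. -/
def Bs (W : WHA B) : Submodule ℂ B := Submodule.span ℂ (Set.range W.εs)

/-- The right adjoint action `b ◁ x = S(x₍₁₎) b x₍₂₎`. -/
def ad (W : WHA B) (b x : B) : B :=
  LinearMap.mul' ℂ B ((TensorProduct.map W.S (LinearMap.mulLeft ℂ b)) (W.Δ x))

/-- `I` is a (right) coideal of `B`: a unital `*`-subalgebra with `Δ(I) ⊆ I ⊗ B`. -/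
def IsCoideal (W : WHA B) (I : Submodule ℂ B) : Prop :=
  (1 : B) ∈ I ∧ (∀ a ∈ I, ∀ b ∈ I, a * b ∈ I) ∧ (∀ a ∈ I, star a ∈ I) ∧
    ∀ a ∈ I, W.Δ a ∈ Submodule.span ℂ {x : B ⊗[ℂ] B | ∃ u ∈ I, ∃ v : B, x = u ⊗ₜ[ℂ] v}

/-- A coideal is invariant if `span{ b ◁ x : b ∈ I, x ∈ B } = I`. -/
def IsInvariant (W : WHA B) (I : Submodule ℂ B) : Prop :=
  Submodule.span ℂ {y : B | ∃ b ∈ I, ∃ x : B, y = W.ad b x} = I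

end WHA

/-- A morphism of weak Hopf `*`-algebras. -/
structure WHAHom {B C : Type} [NormedRing B] [StarRing B] [CStarRing B] [NormedAlgebra ℂ B]
    [StarModule ℂ B] [FiniteDimensional ℂ B] [NormedRing C] [StarRing C] [CStarRing C]
    [NormedAlgebra ℂ C] [StarModule ℂ C] [FiniteDimensional ℂ C]
    (W : WHA B) (W' : WHA C) where
  π : B →⋆ₐ[ℂ] C
  comul_comp : ∀ b : B, W'.Δ (π b) = (TensorProduct.map π.toLinearMap π.toLinearMap) (W.Δ b)
  antipode_comp : ∀ b : B, W'.S (π b) = π (W.S b)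
  counit_comp : ∀ b : B, W'.ε (π b) = W.ε b

/-- A right unitary corepresentation of a WHA on a finite-dimensional Hilbert space `H`:
a partial isometry `U ∈ B(H) ⊗ B` with `(id ⊗ Δ)(U) = U₁₂U₁₃` and `(id ⊗ ε)(U) = id`. -/
structure UCorep {B : Type} [NormedRing B] [StarRing B] [CStarRing B] [NormedAlgebra ℂ B]
    [StarModule ℂ B] [FiniteDimensional ℂ B] (W : WHA B)
    (H : Type) [NormedAddCommGroup H] [InnerProductSpace ℂ H] [FiniteDimensional ℂ H] where
  U : (H →ₗ[ℂ] H) ⊗[ℂ] B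
  partial_isometry : U * tensorStar (H →ₗ[ℂ] H) B U * U = U
  comul_eq : (TensorProduct.map LinearMap.id W.Δ) U =
    ((TensorProduct.map LinearMap.id ((TensorProduct.mk ℂ B B).flip 1)) U) *
      ((TensorProduct.map LinearMap.id (TensorProduct.mk ℂ B B 1)) U)
  counit_eq : (TensorProduct.rid ℂ (H →ₗ[ℂ] H)) ((TensorProduct.map LinearMap.id W.ε) U) =
    LinearMap.id

namespace UCorep

variable {B : Type} [NormedRing B] [StarRing B] [CStarRing B] [NormedAlgebra ℂ B]
  [StarModule ℂ B] [FiniteDimensional ℂ B] {W : WHA B}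
  {H : Type} [NormedAddCommGroup H] [InnerProductSpace ℂ H] [FiniteDimensional ℂ H]

/-- The matrix coefficient `U_{η,ζ} = ⟨U⁽¹⁾ζ, η⟩ U⁽²⁾ ∈ B` of a unitary corepresentation. -/
def matCoef (V : UCorep W H) (η ζ : H) : B :=
  (TensorProduct.lid ℂ B)
    ((TensorProduct.map ((innerSL ℂ η).toLinearMap ∘ₗ LinearMap.applyₗ (R := ℂ) ζ)
      LinearMap.id) V.U)

/-- The left action of the dual `B̂` on `H`: `φ · ζ = ⟨φ, U⁽²⁾⟩ U⁽¹⁾ ζ`. -/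
def dualAct (V : UCorep W H) (φ : Module.Dual ℂ B) (ζ : H) : H :=
  ((TensorProduct.rid ℂ (H →ₗ[ℂ] H)) ((TensorProduct.map LinearMap.id φ) V.U)) ζ

end UCorep

/-- The target counital map as a linear map. -/
def WHA.εtL {B : Type} [NormedRing B] [StarRing B] [CStarRing B] [NormedAlgebra ℂ B]
    [StarModule ℂ B] [FiniteDimensional ℂ B] (W : WHA B) : B →ₗ[ℂ] B :=
  (TensorProduct.lid ℂ B).toLinearMap ∘ₗ TensorProduct.map W.ε LinearMap.id ∘ₗ
    LinearMap.mulLeft ℂ (W.Δ 1) ∘ₗ (TensorProduct.mk ℂ B B).flip 1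

/-- `φ ∈ Ĉ` is a left integral: `(id ⊗ φ)Δ = (ε_t ⊗ φ)Δ`. -/
def IsLeftIntegral {C : Type} [NormedRing C] [StarRing C] [CStarRing C] [NormedAlgebra ℂ C]
    [StarModule ℂ C] [FiniteDimensional ℂ C] (W' : WHA C) (φ : Module.Dual ℂ C) : Prop :=
  ∀ c : C, (TensorProduct.rid ℂ C) ((TensorProduct.map LinearMap.id φ) (W'.Δ c)) =
    (TensorProduct.rid ℂ C) ((TensorProduct.map W'.εtL φ) (W'.Δ c))

/-- The quotient type coideal `I(π) = {b : (π ⊗ id)Δ(b) = (π ⊗ id)((1 ⊗ b)Δ(1))}`. -/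
def quotientCoideal {B C : Type} [NormedRing B] [StarRing B] [CStarRing B]
    [NormedAlgebra ℂ B] [StarModule ℂ B] [FiniteDimensional ℂ B]
    [NormedRing C] [StarRing C] [CStarRing C] [NormedAlgebra ℂ C] [StarModule ℂ C]
    [FiniteDimensional ℂ C] (W : WHA B) (W' : WHA C) (h : WHAHom W W') : Set B :=
  {b : B | (TensorProduct.map h.π.toLinearMap LinearMap.id) (W.Δ b) =
    (TensorProduct.map h.π.toLinearMap LinearMap.id) (((1 : B) ⊗ₜ[ℂ] b) * W.Δ 1)}

section FaithfulTrace

lemma InnerProductSpace.Core.exists_orthonormal_basis {E : Type*} [AddCommGroup E] [Module ℂ E]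
    [FiniteDimensional ℂ E] (core : InnerProductSpace.Core ℂ E) :
    ∃ (n : ℕ) (e : Module.Basis (Fin n) ℂ E),
      ∀ i j, core.inner (e i) (e j) = if i = j then 1 else 0 := by
  let _ : NormedAddCommGroup E := core.toNormedAddCommGroup
  let _ : InnerProductSpace ℂ E := InnerProductSpace.ofCore core.toCore
  let e := stdOrthonormalBasis ℂ E
  refine ⟨_, e.toBasis, fun i j => ?_⟩
  rw [OrthonormalBasis.coe_toBasis]
  exact orthonormal_iff_ite.1 e.orthonormal i j

variable {B : Type*} [NormedRing B] [StarRing B] [CStarRing B] [NormedAlgebra ℂ B]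
  [StarModule ℂ B] [FiniteDimensional ℂ B]

open scoped ComplexOrder in
lemma nonneg_of_mem_spectrum_star_mul_self (x : B) {μ : ℂ} (hμ : μ ∈ spectrum ℂ (star x * x)) :
    0 ≤ μ := by
  have : CompleteSpace B := FiniteDimensional.complete ℂ B
  let _ : CStarAlgebra B := { ‹NormedRing B›, ‹StarRing B›, ‹CStarRing B›, ‹NormedAlgebra ℂ B›,
    ‹StarModule ℂ B›, ‹CompleteSpace B› with }
  have hre : μ = μ.re := (IsSelfAdjoint.star_mul_self x).mem_spectrum_eq_re hμ
  have h1 : μ.re ∈ spectrum ℝ (star x * x) := by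
    rw [← spectrum.algebraMap_mem_iff ℂ]
    exact hre ▸ hμ
  rw [hre]
  exact_mod_cast spectrum_star_mul_self_nonneg _ h1

lemma spectrum_lmul {A : Type*} [Ring A] [Algebra ℂ A] (y : A) :
    spectrum ℂ (Algebra.lmul ℂ A y) = spectrum ℂ y := by
  ext μ
  rw [spectrum.mem_iff, spectrum.mem_iff, ← AlgHom.commutes (Algebra.lmul ℂ A), ← map_sub,
    Algebra.lmul_isUnit_iff]

open scoped ComplexOrder in
lemma trace_lmul_star_mul_self_nonneg (x : B) :
    0 ≤ LinearMap.trace ℂ B (Algebra.lmul ℂ B (star x * x)) := by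
  rw [Module.End.trace_eq_sum_roots_charpoly_of_splits (IsAlgClosed.splits _)]
  refine Multiset.sum_nonneg fun μ hμ => ?_
  rw [Polynomial.mem_roots (LinearMap.charpoly_monic _).ne_zero,
    ← Module.End.hasEigenvalue_iff_isRoot_charpoly,
    Module.End.hasEigenvalue_iff_mem_spectrum, spectrum_lmul] at hμ
  exact nonneg_of_mem_spectrum_star_mul_self x hμ

open scoped ComplexOrder in
lemma eq_zero_of_trace_lmul_star_mul_self_eq_zero (x : B)
    (h : LinearMap.trace ℂ B (Algebra.lmul ℂ B (star x * x)) = 0) : x = 0 := by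
  have : CompleteSpace B := FiniteDimensional.complete ℂ B
  let _ : CStarAlgebra B := { ‹NormedRing B›, ‹StarRing B›, ‹CStarRing B›, ‹NormedAlgebra ℂ B›,
    ‹StarModule ℂ B›, ‹CompleteSpace B› with }
  have hmem : ∀ μ : ℂ, μ ∈ spectrum ℂ (star x * x) ↔
      μ ∈ (Algebra.lmul ℂ B (star x * x)).charpoly.roots := fun μ => by
    rw [Polynomial.mem_roots (LinearMap.charpoly_monic _).ne_zero,
      ← Module.End.hasEigenvalue_iff_isRoot_charpoly,
      Module.End.hasEigenvalue_iff_mem_spectrum, spectrum_lmul]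
  rw [Module.End.trace_eq_sum_roots_charpoly_of_splits (IsAlgClosed.splits _)] at h
  have hzero : ∀ μ ∈ spectrum ℂ (star x * x), μ = 0 := fun μ hμ => by
    refine le_antisymm ?_ (nonneg_of_mem_spectrum_star_mul_self x hμ)
    rw [← h]
    exact Multiset.single_le_sum (fun ν hν =>
      nonneg_of_mem_spectrum_star_mul_self x ((hmem ν).2 hν)) _ ((hmem μ).1 hμ)
  have hr : spectralRadius ℂ (star x * x) = 0 := by
    rw [spectralRadius]
    simp only [ENNReal.iSup_eq_zero]
    intro μ hμ
    simp [hzero μ hμ]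
  rw [(IsSelfAdjoint.star_mul_self x).spectralRadius_eq_nnnorm] at hr
  exact CStarRing.star_mul_self_eq_zero_iff x |>.1 (by simpa using hr)

/-- A finite-dimensional `C*`-algebra has a linear functional and a basis which is orthonormal for
the associated sesquilinear form. -/
lemma exists_orthonormal_basis_of_functional :
    ∃ (τ : B →ₗ[ℂ] ℂ) (n : ℕ) (e : Module.Basis (Fin n) ℂ B),
      ∀ i j, τ (star (e i) * e j) = if i = j then 1 else 0 := by
  let τ : B →ₗ[ℂ] ℂ := LinearMap.trace ℂ B ∘ₗ (Algebra.lmul ℂ B).toLinearMap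
  have hnn := trace_lmul_star_mul_self_nonneg (B := B)
  have hsymm : ∀ x y : B, (starRingEnd ℂ) (τ (star y * x)) = τ (star x * y) := by
    intro x y
    have hreal : ∀ z : B, (starRingEnd ℂ) (τ (star z * z)) = τ (star z * z) := fun z =>
      Complex.conj_eq_iff_im.2 (Complex.nonneg_iff.1 (hnn z)).2.symm
    have h1 := hreal (x + y)
    have h2 := hreal (x + Complex.I • y)
    simp only [star_add, star_smul, add_mul, mul_add, map_add, hreal, smul_mul_assoc,
      mul_smul_comm, map_smul, smul_eq_mul, map_mul, RCLike.star_def, Complex.conj_I] at h1 h2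
    have h3 : Complex.I * Complex.I = -1 := Complex.I_mul_I
    simp only [map_neg, Complex.conj_I] at h2
    linear_combination (h1 - Complex.I * h2) / 2 +
      ((starRingEnd ℂ) (τ (star y * x)) + τ (star y * x) - τ (star x * y)
        - (starRingEnd ℂ) (τ (star x * y))) / 2 * h3
  let core : InnerProductSpace.Core ℂ B :=
    { inner := fun x y => τ (star x * y)
      conj_inner_symm := fun x y => hsymm x y
      re_inner_nonneg := fun x => (Complex.nonneg_iff.1 (hnn x)).1
      add_left := fun x y z => by simp [add_mul]
      smul_left := fun x y r => by simp
      definite := fun x hx => eq_zero_of_trace_lmul_star_mul_self_eq_zero x hx }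
  obtain ⟨n, e, he⟩ := core.exists_orthonormal_basis
  exact ⟨τ, n, e, he⟩

/-- The involution on matrices over `B ⊗ B` is proper. -/
lemma Matrix.tensor_eq_zero_of_star_mul_self {n : Type*} [Fintype n] [DecidableEq n]
    (t : Matrix n n (B ⊗[ℂ] B)) (h : star t * t = 0) : t = 0 := by
  obtain ⟨τ, d, e, he⟩ := exists_orthonormal_basis_of_functional (B := B)
  let b := e.tensorProduct e
  let σ : B ⊗[ℂ] B →ₗ[ℂ] ℂ := LinearMap.mul' ℂ ℂ ∘ₗ TensorProduct.map τ τ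
  have hσ : ∀ s : B ⊗[ℂ] B, σ (star s * s) = ((∑ p, ‖b.repr s p‖ ^ 2 : ℝ) : ℂ) := by
    intro s
    conv_lhs => rw [← b.sum_repr s]
    simp only [star_sum, star_smul, Finset.sum_mul_sum, map_sum, smul_mul_smul_comm, map_smul]
    have hb : ∀ p q, σ (star (b p) * b q) = if p = q then 1 else 0 := by
      rintro ⟨p, p'⟩ ⟨q, q'⟩
      simp only [b, σ, Module.Basis.tensorProduct_apply, TensorProduct.star_tmul,
        Algebra.TensorProduct.tmul_mul_tmul, LinearMap.comp_apply, TensorProduct.map_tmul, he,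
        LinearMap.mul'_apply, Prod.mk.injEq]
      split_ifs <;> simp_all
    simp [hb, ← Complex.conj_mul']
  ext i j
  have hj : ∑ k, star (t k j) * t k j = 0 := by
    have := congrFun₂ h j j
    simpa [Matrix.mul_apply, Matrix.star_apply] using this
  have hj' := congrArg σ hj
  rw [map_sum, map_zero] at hj'
  simp only [hσ] at hj'
  rw [← Complex.ofReal_sum, Complex.ofReal_eq_zero,
    Finset.sum_eq_zero_iff_of_nonneg (fun _ _ => by positivity)] at hj'
  have hi := hj' i (Finset.mem_univ _)
  rw [Finset.sum_eq_zero_iff_of_nonneg (fun _ _ => by positivity)] at hi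
  refine b.ext_elem fun p => ?_
  simpa using hi p (Finset.mem_univ _)

end FaithfulTrace
section Corepresentation

lemma tensorStar_eq_star {M N : Type} [AddCommGroup M] [Module ℂ M] [Module.Finite ℂ M]
    [Module.Free ℂ M] [StarAddMonoid M] [StarModule ℂ M] [AddCommGroup N] [Module ℂ N]
    [Module.Finite ℂ N] [Module.Free ℂ N] [StarAddMonoid N] [StarModule ℂ N] (t : M ⊗[ℂ] N) :
    tensorStar M N t = star t := by
  let bM := Module.Free.chooseBasis ℂ M
  let bN := Module.Free.chooseBasis ℂ N
  conv_rhs => rw [← (bM.tensorProduct bN).sum_repr t]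
  simp only [star_sum, star_smul, Module.Basis.tensorProduct_apply', TensorProduct.star_tmul]
  rfl

section Entry

variable {n : ℕ} {A A' : Type} [Ring A] [Algebra ℂ A] [Ring A'] [Algebra ℂ A']

/-- The `(i, j)` entry of an element of `B(ℂⁿ) ⊗ A`, seen as a matrix over `A`. -/
def tensorEntry (A : Type) [Ring A] [Algebra ℂ A] (i j : Fin n) :
    (EuclideanSpace ℂ (Fin n) →ₗ[ℂ] EuclideanSpace ℂ (Fin n)) ⊗[ℂ] A →ₗ[ℂ] A :=
  (TensorProduct.lid ℂ A).toLinearMap ∘ₗ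
    TensorProduct.map ((innerSL ℂ (EuclideanSpace.single i (1 : ℂ))).toLinearMap ∘ₗ
      LinearMap.applyₗ (R := ℂ) (EuclideanSpace.single j (1 : ℂ))) LinearMap.id

@[simp] lemma tensorEntry_tmul (i j : Fin n)
    (f : EuclideanSpace ℂ (Fin n) →ₗ[ℂ] EuclideanSpace ℂ (Fin n)) (a : A) :
    tensorEntry A i j (f ⊗ₜ a) = (f (EuclideanSpace.single j (1 : ℂ))) i • a := by
  simp [tensorEntry, EuclideanSpace.inner_single_left]

lemma tensorEntry_mul (i j : Fin n)
    (X Y : (EuclideanSpace ℂ (Fin n) →ₗ[ℂ] EuclideanSpace ℂ (Fin n)) ⊗[ℂ] A) :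
    tensorEntry A i j (X * Y) = ∑ k, tensorEntry A i k X * tensorEntry A k j Y := by
  induction X using TensorProduct.induction_on with
  | zero => simp
  | add X X' hX hX' => simp only [add_mul, map_add, hX, hX', Finset.sum_add_distrib]
  | tmul f a =>
    induction Y using TensorProduct.induction_on with
    | zero => simp
    | add Y Y' hY hY' => simp only [mul_add, map_add, hY, hY', Finset.sum_add_distrib]
    | tmul g b =>
      simp only [Algebra.TensorProduct.tmul_mul_tmul, tensorEntry_tmul, smul_mul_smul_comm,
        Module.End.mul_apply, ← Finset.sum_smul]
      congr 1
      conv_lhs => rw [← (EuclideanSpace.basisFun (Fin n) ℂ).sum_repr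
        (g (EuclideanSpace.single j 1))]
      simp [mul_comm]

lemma tensorEntry_map (i j : Fin n) (f : A →ₗ[ℂ] A')
    (X : (EuclideanSpace ℂ (Fin n) →ₗ[ℂ] EuclideanSpace ℂ (Fin n)) ⊗[ℂ] A) :
    tensorEntry A' i j (TensorProduct.map LinearMap.id f X) = f (tensorEntry A i j X) := by
  induction X using TensorProduct.induction_on with
  | zero => simp
  | add X X' hX hX' => simp only [map_add, hX, hX']
  | tmul g a => simp

lemma tensorEntry_star [StarRing A] [StarModule ℂ A] (i j : Fin n)
    (X : (EuclideanSpace ℂ (Fin n) →ₗ[ℂ] EuclideanSpace ℂ (Fin n)) ⊗[ℂ] A) :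
    tensorEntry A i j (star X) = star (tensorEntry A j i X) := by
  induction X using TensorProduct.induction_on with
  | zero => simp
  | add X X' hX hX' => simp only [star_add, map_add, hX, hX']
  | tmul g a =>
    rw [TensorProduct.star_tmul, tensorEntry_tmul, tensorEntry_tmul, star_smul]
    congr 1
    have := LinearMap.adjoint_inner_right g (EuclideanSpace.single i (1 : ℂ))
      (EuclideanSpace.single j (1 : ℂ))
    simpa [EuclideanSpace.inner_single_left, EuclideanSpace.inner_single_right,
      LinearMap.star_eq_adjoint] using this

end Entry

variable {B : Type} [NormedRing B] [StarRing B] [CStarRing B] [NormedAlgebra ℂ B]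
  [StarModule ℂ B] [FiniteDimensional ℂ B] {W : WHA B} {n : ℕ}

lemma WHA.comul_star' (W : WHA B) (b : B) : W.Δ (star b) = star (W.Δ b) := by
  rw [W.comul_star, tensorStar_eq_star]

namespace UCorep

/-- The matrix over `B` of a corepresentation on `ℂⁿ`. -/
def coefMatrix (V : UCorep W (EuclideanSpace ℂ (Fin n))) : Matrix (Fin n) (Fin n) B :=
  Matrix.of fun i j => V.matCoef (EuclideanSpace.single i 1) (EuclideanSpace.single j 1)

variable (V : UCorep W (EuclideanSpace ℂ (Fin n)))

lemma coefMatrix_apply (i j : Fin n) : V.coefMatrix i j = tensorEntry B i j V.U := rfl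

lemma comul_coefMatrix (i j : Fin n) :
    W.Δ (V.coefMatrix i j) = ∑ k, V.coefMatrix i k ⊗ₜ[ℂ] V.coefMatrix k j := by
  simp only [coefMatrix_apply]
  rw [← tensorEntry_map, V.comul_eq, tensorEntry_mul]
  refine Finset.sum_congr rfl fun k _ => ?_
  rw [tensorEntry_map, tensorEntry_map]
  simp

lemma counit_coefMatrix (i j : Fin n) :
    W.ε (V.coefMatrix i j) = (1 : Matrix (Fin n) (Fin n) ℂ) i j := by
  have h := congrArg (fun f => (f (EuclideanSpace.single j (1 : ℂ))) i) V.counit_eq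
  rw [coefMatrix_apply, ← tensorEntry_map]
  have key : ∀ X : (EuclideanSpace ℂ (Fin n) →ₗ[ℂ] EuclideanSpace ℂ (Fin n)) ⊗[ℂ] ℂ,
      tensorEntry ℂ i j X =
        (TensorProduct.rid ℂ (EuclideanSpace ℂ (Fin n) →ₗ[ℂ] EuclideanSpace ℂ (Fin n)) X)
          (EuclideanSpace.single j (1 : ℂ)) i := by
    intro X
    induction X using TensorProduct.induction_on with
    | zero => simp
    | add X X' hX hX' => simp only [map_add, hX, hX', LinearMap.add_apply, PiLp.add_apply]
    | tmul g a => simp [mul_comm]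
  rw [key, h]
  simp [Matrix.one_apply]

lemma coefMatrix_mul_star_mul_self :
    V.coefMatrix * star V.coefMatrix * V.coefMatrix = V.coefMatrix := by
  ext i j
  have h := congrArg (tensorEntry B i j) V.partial_isometry
  rw [tensorStar_eq_star, tensorEntry_mul] at h
  simp only [tensorEntry_mul, tensorEntry_star] at h
  simpa [Matrix.mul_apply, Matrix.star_apply, coefMatrix_apply] using h

lemma matCoef_eq_sum (η ζ : EuclideanSpace ℂ (Fin n)) :
    V.matCoef η ζ = ∑ i, ∑ j, (star (η i) * ζ j) • V.coefMatrix i j := by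
  simp only [coefMatrix_apply, matCoef]
  generalize V.U = X
  induction X using TensorProduct.induction_on with
  | zero => simp
  | add X X' hX hX' => simp only [map_add, hX, hX', smul_add, Finset.sum_add_distrib]
  | tmul g a =>
    simp only [map_tmul, LinearMap.coe_comp, Function.comp_apply, LinearMap.applyₗ_apply_apply,
      ContinuousLinearMap.coe_coe, innerSL_apply_apply, LinearMap.id_apply, lid_tmul,
      tensorEntry_tmul, smul_smul, ← Finset.sum_smul]
    congr 1
    conv_lhs => rw [← (EuclideanSpace.basisFun (Fin n) ℂ).sum_repr ζ]
    simp only [PiLp.inner_apply, map_sum, map_smul]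
    refine Finset.sum_congr rfl fun i _ => ?_
    simp [Finset.mul_sum, mul_assoc, mul_comm, mul_left_comm]

lemma dualAct_apply (φ : Module.Dual ℂ B) (ξ : EuclideanSpace ℂ (Fin n)) (i : Fin n) :
    V.dualAct φ ξ i = ∑ j, φ (V.coefMatrix i j) * ξ j := by
  simp only [coefMatrix_apply, dualAct]
  generalize V.U = X
  induction X using TensorProduct.induction_on with
  | zero => simp
  | add X X' hX hX' =>
    simp only [map_add, hX, hX', add_mul, Finset.sum_add_distrib, LinearMap.add_apply,
      PiLp.add_apply]
  | tmul g a =>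
    conv_lhs => rw [← (EuclideanSpace.basisFun (Fin n) ℂ).sum_repr ξ]
    simp [mul_comm]

end UCorep

end Corepresentation

lemma TensorProduct.map_mul_of_mul {A A' B B' : Type*} [Ring A] [Algebra ℂ A] [Ring A']
    [Algebra ℂ A'] [Ring B] [Algebra ℂ B] [Ring B'] [Algebra ℂ B'] (f : A →ₗ[ℂ] A')
    (g : B →ₗ[ℂ] B') (hf : ∀ a b, f (a * b) = f a * f b) (hg : ∀ a b, g (a * b) = g a * g b)
    (x y : A ⊗[ℂ] B) : map f g (x * y) = map f g x * map f g y := by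
  induction x using TensorProduct.induction_on with
  | zero => simp
  | add x x' hx hx' => simp only [add_mul, map_add, hx, hx']
  | tmul a b =>
    induction y using TensorProduct.induction_on with
    | zero => simp
    | add y y' hy hy' => simp only [mul_add, map_add, hy, hy']
    | tmul c d => simp [hf, hg]

namespace WHA

section Legs

variable {A : Type} [Ring A] [Algebra ℂ A]

/-- The embedding `x ↦ 1 ⊗ x` of `A ⊗ A` into `(A ⊗ A) ⊗ A`. -/
def legSnd : A ⊗[ℂ] A →ₐ[ℂ] (A ⊗[ℂ] A) ⊗[ℂ] A :=
  (Algebra.TensorProduct.assoc ℂ ℂ ℂ A A A).symm.toAlgHom.comp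
    Algebra.TensorProduct.includeRight

/-- The embedding `x ↦ x ⊗ 1` of `A ⊗ A` into `(A ⊗ A) ⊗ A`. -/
def legFst : A ⊗[ℂ] A →ₐ[ℂ] (A ⊗[ℂ] A) ⊗[ℂ] A := Algebra.TensorProduct.includeLeft

@[simp] lemma legFst_apply (x : A ⊗[ℂ] A) : legFst x = x ⊗ₜ[ℂ] (1 : A) := rfl
@[simp] lemma legSnd_tmul (x y : A) : legSnd (x ⊗ₜ[ℂ] y) = ((1 : A) ⊗ₜ[ℂ] x) ⊗ₜ[ℂ] y := rfl

lemma star_legSnd [StarRing A] [StarModule ℂ A] (x : A ⊗[ℂ] A) :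
    star (legSnd x) = legSnd (star x) := by
  induction x using TensorProduct.induction_on with
  | zero => simp
  | add x y hx hy => simp only [map_add, star_add, hx, hy]
  | tmul a b => simp

lemma legFst_tmul_one_mul_legSnd (x : A) (t : A ⊗[ℂ] A) :
    legFst (x ⊗ₜ[ℂ] (1 : A)) * legSnd t = legSnd t * legFst (x ⊗ₜ[ℂ] (1 : A)) := by
  induction t using TensorProduct.induction_on with
  | zero => simp
  | add x y hx hy => simp only [map_add, mul_add, add_mul, hx, hy]
  | tmul c d => simp

lemma legSnd_one_tmul_mul_legFst (x : A) (t : A ⊗[ℂ] A) :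
    legSnd ((1 : A) ⊗ₜ[ℂ] x) * legFst t = legFst t * legSnd ((1 : A) ⊗ₜ[ℂ] x) := by
  induction t using TensorProduct.induction_on with
  | zero => simp
  | add x y hx hy => simp only [map_add, mul_add, add_mul, hx, hy]
  | tmul c d => simp

end Legs

variable {B : Type} [NormedRing B] [StarRing B] [CStarRing B] [NormedAlgebra ℂ B]
  [StarModule ℂ B] [FiniteDimensional ℂ B] (W : WHA B)

/-- The source counital map as a linear map. -/
def εsL : B →ₗ[ℂ] B :=
  (TensorProduct.rid ℂ B).toLinearMap ∘ₗ TensorProduct.map LinearMap.id W.ε ∘ₗ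
    LinearMap.mulRight ℂ (W.Δ 1) ∘ₗ TensorProduct.mk ℂ B B 1

/-- The map `Δ ⊗ id` with values in `(B ⊗ B) ⊗ B`. -/
def comulFst : B ⊗[ℂ] B →ₗ[ℂ] (B ⊗[ℂ] B) ⊗[ℂ] B := map W.Δ LinearMap.id

/-- The map `id ⊗ Δ` with values in `(B ⊗ B) ⊗ B`. -/
def comulSnd : B ⊗[ℂ] B →ₗ[ℂ] (B ⊗[ℂ] B) ⊗[ℂ] B :=
  (TensorProduct.assoc ℂ B B B).symm.toLinearMap ∘ₗ map LinearMap.id W.Δ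

lemma star_comulFst (x : B ⊗[ℂ] B) : star (W.comulFst x) = W.comulFst (star x) := by
  induction x using TensorProduct.induction_on with
  | zero => simp
  | add x y hx hy => simp only [map_add, star_add, hx, hy]
  | tmul a b => simp [comulFst, W.comul_star']

lemma comulFst_mul (x y : B ⊗[ℂ] B) : W.comulFst (x * y) = W.comulFst x * W.comulFst y :=
  map_mul_of_mul _ _ W.comul_mul (fun _ _ => rfl) x y

lemma comulSnd_mul (x y : B ⊗[ℂ] B) : W.comulSnd (x * y) = W.comulSnd x * W.comulSnd y := by
  rw [comulSnd, LinearMap.comp_apply,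
    map_mul_of_mul LinearMap.id W.Δ (fun a b => rfl) W.comul_mul]
  exact map_mul (Algebra.TensorProduct.assoc ℂ ℂ ℂ B B B).symm _ _

lemma comulSnd_comul (b : B) : W.comulSnd (W.Δ b) = W.comulFst (W.Δ b) := by
  rw [comulSnd, LinearMap.comp_apply, ← W.coassoc]
  exact LinearEquiv.symm_apply_apply _ _

lemma comulFst_comul_one : W.comulFst (W.Δ 1) = legFst (W.Δ 1) * legSnd (W.Δ 1) :=
  W.weak_comul_one

lemma star_comul_one : star (W.Δ 1) = W.Δ 1 := by rw [← W.comul_star', star_one]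

lemma comulFst_comul_one' : W.comulFst (W.Δ 1) = legSnd (W.Δ 1) * legFst (W.Δ 1) := by
  have h := congrArg star W.comulFst_comul_one
  rw [star_comulFst, star_mul, star_legSnd, legFst_apply, star_tmul, star_comul_one,
    star_one] at h
  exact h

lemma comul_one_mul_comul (x : B) : W.Δ 1 * W.Δ x = W.Δ x := by rw [← W.comul_mul, one_mul]
lemma comul_mul_comul_one (x : B) : W.Δ x * W.Δ 1 = W.Δ x := by rw [← W.comul_mul, mul_one]

/-- `ε` applied to the left leg. -/
def counitLeft : B ⊗[ℂ] B →ₗ[ℂ] B :=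
  (TensorProduct.lid ℂ B).toLinearMap ∘ₗ map W.ε LinearMap.id

/-- `ε` applied to the right leg. -/
def counitRight : B ⊗[ℂ] B →ₗ[ℂ] B :=
  (TensorProduct.rid ℂ B).toLinearMap ∘ₗ map LinearMap.id W.ε

@[simp] lemma counitLeft_tmul (a b : B) : W.counitLeft (a ⊗ₜ b) = W.ε a • b := by
  simp [counitLeft]
@[simp] lemma counitRight_tmul (a b : B) : W.counitRight (a ⊗ₜ b) = W.ε b • a := by
  simp [counitRight]
@[simp] lemma counitLeft_comul (b : B) : W.counitLeft (W.Δ b) = b := W.counit_left b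
@[simp] lemma counitRight_comul (b : B) : W.counitRight (W.Δ b) = b := W.counit_right b

lemma εtL_apply (b : B) : W.εtL b = W.counitLeft (W.Δ 1 * (b ⊗ₜ[ℂ] (1 : B))) := rfl
lemma εsL_apply (b : B) : W.εsL b = W.counitRight (((1 : B) ⊗ₜ[ℂ] b) * W.Δ 1) := rfl

/-- `ε` applied to the middle leg. -/
def counitMid : (B ⊗[ℂ] B) ⊗[ℂ] B →ₗ[ℂ] B ⊗[ℂ] B := map W.counitRight LinearMap.id

lemma counitMid_comulFst (x : B ⊗[ℂ] B) : W.counitMid (W.comulFst x) = x := by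
  rw [counitMid, comulFst, ← LinearMap.comp_apply, ← map_comp]
  have : W.counitRight ∘ₗ W.Δ = LinearMap.id := LinearMap.ext W.counit_right
  simp [this]

lemma counitMid_comulSnd (x : B ⊗[ℂ] B) : W.counitMid (W.comulSnd x) = x := by
  have h : ∀ y : B ⊗[ℂ] (B ⊗[ℂ] B), W.counitMid ((TensorProduct.assoc ℂ B B B).symm y) =
      map LinearMap.id W.counitLeft y := by
    intro y
    induction y using TensorProduct.induction_on with
    | zero => simp
    | add x y hx hy => simp only [map_add, hx, hy]
    | tmul a y =>
      induction y using TensorProduct.induction_on with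
      | zero => simp
      | add x y hx hy => simp only [map_add, hx, hy, tmul_add]
      | tmul b c => simp [counitMid, smul_tmul]
  rw [comulSnd, LinearMap.comp_apply, LinearEquiv.coe_coe, h, ← LinearMap.comp_apply, ← map_comp]
  have : W.counitLeft ∘ₗ W.Δ = LinearMap.id := LinearMap.ext W.counit_left
  simp [this]

lemma map_id_εtL (t : B ⊗[ℂ] B) :
    map LinearMap.id W.εtL t = W.counitMid (legSnd (W.Δ 1) * legFst t) := by
  induction t using TensorProduct.induction_on with
  | zero => simp
  | add x y hx hy => simp only [map_add, hx, hy, mul_add]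
  | tmul a b =>
    rw [map_tmul, εtL_apply]
    generalize W.Δ 1 = z
    induction z using TensorProduct.induction_on with
    | zero => simp
    | add x y hx hy => simp only [map_add, add_mul, tmul_add, hx, hy]
    | tmul c d => simp [counitMid, smul_tmul]

lemma map_εsL_id (t : B ⊗[ℂ] B) :
    map W.εsL LinearMap.id t = W.counitMid (legSnd t * legFst (W.Δ 1)) := by
  induction t using TensorProduct.induction_on with
  | zero => simp
  | add x y hx hy => simp only [map_add, hx, hy, add_mul]
  | tmul a b =>
    rw [map_tmul, εsL_apply]
    generalize W.Δ 1 = z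
    induction z using TensorProduct.induction_on with
    | zero => simp
    | add x y hx hy => simp only [map_add, mul_add, add_tmul, hx, hy]
    | tmul c d => simp [counitMid]

lemma map_id_εtL_comul (x : B) :
    map LinearMap.id W.εtL (W.Δ x) = W.Δ 1 * (x ⊗ₜ[ℂ] (1 : B)) := by
  have h : W.comulFst (x ⊗ₜ[ℂ] (1 : B)) = legFst (W.Δ x) := rfl
  rw [map_id_εtL, ← W.comul_one_mul_comul x, map_mul legFst, ← mul_assoc, ← comulFst_comul_one', ← h,
    ← comulFst_mul, counitMid_comulFst]

lemma map_εsL_id_comul (x : B) :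
    map W.εsL LinearMap.id (W.Δ x) = ((1 : B) ⊗ₜ[ℂ] x) * W.Δ 1 := by
  have h : W.comulSnd ((1 : B) ⊗ₜ[ℂ] x) = legSnd (W.Δ x) := rfl
  rw [map_εsL_id, ← W.comul_mul_comul_one x, map_mul legSnd, mul_assoc, ← comulFst_comul_one', ← h,
    ← comulSnd_comul, ← comulSnd_mul, counitMid_comulSnd]

lemma comulSnd_mul_tmul_one (t : B ⊗[ℂ] B) (x : B) :
    W.comulSnd (t * (x ⊗ₜ[ℂ] (1 : B))) = W.comulSnd t * legFst (x ⊗ₜ[ℂ] (1 : B)) := by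
  induction t using TensorProduct.induction_on with
  | zero => simp
  | add x y hx hy => simp only [map_add, add_mul, hx, hy]
  | tmul c d =>
    simp only [Algebra.TensorProduct.tmul_mul_tmul, mul_one, comulSnd, LinearMap.comp_apply,
      map_tmul, LinearMap.id_apply]
    generalize W.Δ d = s
    induction s using TensorProduct.induction_on with
    | zero => simp
    | add x y hx hy => simp only [map_add, tmul_add, add_mul, hx, hy]
    | tmul c d => simp

lemma comulFst_one_tmul_mul (t : B ⊗[ℂ] B) (x : B) :
    W.comulFst (((1 : B) ⊗ₜ[ℂ] x) * t) = legSnd ((1 : B) ⊗ₜ[ℂ] x) * W.comulFst t := by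
  induction t using TensorProduct.induction_on with
  | zero => simp
  | add x y hx hy => simp only [map_add, mul_add, hx, hy]
  | tmul c d =>
    simp only [Algebra.TensorProduct.tmul_mul_tmul, one_mul, comulFst, map_tmul,
      LinearMap.id_apply, legSnd_tmul, ← Algebra.TensorProduct.one_def]

/-- `ε` applied to the first of three legs. -/
def counitFst : (B ⊗[ℂ] B) ⊗[ℂ] B →ₗ[ℂ] B ⊗[ℂ] B := map W.counitLeft LinearMap.id

/-- `ε` applied to the last of three legs. -/
def counitLast : (B ⊗[ℂ] B) ⊗[ℂ] B →ₗ[ℂ] B ⊗[ℂ] B :=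
  (TensorProduct.rid ℂ (B ⊗[ℂ] B)).toLinearMap ∘ₗ map LinearMap.id W.ε

lemma counitFst_comulSnd (t : B ⊗[ℂ] B) : W.counitFst (W.comulSnd t) = W.Δ (W.counitLeft t) := by
  induction t using TensorProduct.induction_on with
  | zero => simp
  | add x y hx hy => simp only [map_add, hx, hy]
  | tmul c d =>
    simp only [comulSnd, LinearMap.comp_apply, map_tmul, LinearMap.id_apply, counitLeft_tmul,
      map_smul]
    generalize W.Δ d = s
    induction s using TensorProduct.induction_on with
    | zero => simp
    | add x y hx hy => simp only [map_add, tmul_add, smul_add, hx, hy]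
    | tmul c d => simp [counitFst, smul_tmul']

lemma counitLast_comulFst (t : B ⊗[ℂ] B) :
    W.counitLast (W.comulFst t) = W.Δ (W.counitRight t) := by
  induction t using TensorProduct.induction_on with
  | zero => simp
  | add x y hx hy => simp only [map_add, hx, hy]
  | tmul c d => simp [counitLast, comulFst]

lemma counitFst_legSnd_mul_legFst (s t : B ⊗[ℂ] B) :
    W.counitFst (legSnd s * legFst t) = s * (W.counitLeft t ⊗ₜ[ℂ] (1 : B)) := by
  induction t using TensorProduct.induction_on with
  | zero => simp
  | add x y hx hy => simp only [map_add, mul_add, add_tmul, hx, hy]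
  | tmul c d =>
    induction s using TensorProduct.induction_on with
    | zero => simp
    | add x y hx hy => simp only [map_add, add_mul, hx, hy]
    | tmul a b => simp [counitFst]

lemma counitFst_legFst_mul_legSnd (s t : B ⊗[ℂ] B) :
    W.counitFst (legFst t * legSnd s) = (W.counitLeft t ⊗ₜ[ℂ] (1 : B)) * s := by
  induction t using TensorProduct.induction_on with
  | zero => simp
  | add x y hx hy => simp only [map_add, add_mul, add_tmul, hx, hy]
  | tmul c d =>
    induction s using TensorProduct.induction_on with
    | zero => simp
    | add x y hx hy => simp only [map_add, mul_add, hx, hy]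
    | tmul a b => simp [counitFst]

lemma counitLast_legSnd_mul_legFst (s t : B ⊗[ℂ] B) :
    W.counitLast (legSnd s * legFst t) = ((1 : B) ⊗ₜ[ℂ] W.counitRight s) * t := by
  induction t using TensorProduct.induction_on with
  | zero => simp
  | add x y hx hy => simp only [map_add, mul_add, hx, hy]
  | tmul c d =>
    induction s using TensorProduct.induction_on with
    | zero => simp
    | add x y hx hy => simp only [map_add, add_mul, tmul_add, hx, hy]
    | tmul a b => simp [counitLast]

lemma counitLast_legFst_mul_legSnd (s t : B ⊗[ℂ] B) :
    W.counitLast (legFst t * legSnd s) = t * ((1 : B) ⊗ₜ[ℂ] W.counitRight s) := by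
  induction t using TensorProduct.induction_on with
  | zero => simp
  | add x y hx hy => simp only [map_add, add_mul, hx, hy]
  | tmul c d =>
    induction s using TensorProduct.induction_on with
    | zero => simp
    | add x y hx hy => simp only [map_add, mul_add, tmul_add, hx, hy]
    | tmul a b => simp [counitLast]

lemma comul_εtL (x : B) : W.Δ (W.εtL x) = W.Δ 1 * (W.εtL x ⊗ₜ[ℂ] (1 : B)) := by
  conv_lhs => rw [εtL_apply, ← counitFst_comulSnd, comulSnd_mul_tmul_one, comulSnd_comul,
    comulFst_comul_one', mul_assoc, ← map_mul, counitFst_legSnd_mul_legFst, ← εtL_apply]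

lemma comul_εtL' (x : B) : W.Δ (W.εtL x) = (W.εtL x ⊗ₜ[ℂ] (1 : B)) * W.Δ 1 := by
  conv_lhs => rw [εtL_apply, ← counitFst_comulSnd, comulSnd_mul_tmul_one, comulSnd_comul,
    comulFst_comul_one, mul_assoc, ← legFst_tmul_one_mul_legSnd, ← mul_assoc, ← map_mul,
    counitFst_legFst_mul_legSnd, ← εtL_apply]

lemma comul_εsL (x : B) : W.Δ (W.εsL x) = ((1 : B) ⊗ₜ[ℂ] W.εsL x) * W.Δ 1 := by
  conv_lhs => rw [εsL_apply, ← counitLast_comulFst, comulFst_one_tmul_mul,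
    comulFst_comul_one', ← mul_assoc, ← map_mul, counitLast_legSnd_mul_legFst, ← εsL_apply]

lemma comul_εsL' (x : B) : W.Δ (W.εsL x) = W.Δ 1 * ((1 : B) ⊗ₜ[ℂ] W.εsL x) := by
  conv_lhs => rw [εsL_apply, ← counitLast_comulFst, comulFst_one_tmul_mul,
    comulFst_comul_one, ← mul_assoc, legSnd_one_tmul_mul_legFst, mul_assoc, ← map_mul,
    counitLast_legFst_mul_legSnd, ← εsL_apply]

@[simp] lemma εtL_one : W.εtL 1 = 1 := by
  rw [εtL_apply, ← Algebra.TensorProduct.one_def, mul_one, counitLeft_comul]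

@[simp] lemma εsL_one : W.εsL 1 = 1 := by
  rw [εsL_apply, ← Algebra.TensorProduct.one_def, one_mul, counitRight_comul]

lemma εsL_eq_of_comul {z : B} (h : W.Δ z = ((1 : B) ⊗ₜ[ℂ] z) * W.Δ 1) : W.εsL z = z := by
  rw [εsL_apply, ← h, counitRight_comul]

lemma εtL_eq_of_comul {z : B} (h : W.Δ z = W.Δ 1 * (z ⊗ₜ[ℂ] (1 : B))) : W.εtL z = z := by
  rw [εtL_apply, ← h, counitLeft_comul]

lemma εsL_εsL (x : B) : W.εsL (W.εsL x) = W.εsL x := W.εsL_eq_of_comul (W.comul_εsL x)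

lemma antipode_left' (b : B) :
    LinearMap.mul' ℂ B (map LinearMap.id W.S (W.Δ b)) = W.εtL b := W.antipode_left b

lemma antipode_right' (b : B) :
    LinearMap.mul' ℂ B (map W.S LinearMap.id (W.Δ b)) = W.εsL b := W.antipode_right b

lemma mul_map_εtL_id_comul (x : B) : LinearMap.mul' ℂ B (map W.εtL LinearMap.id (W.Δ x)) = x := by
  have h : ∀ t : B ⊗[ℂ] B,
      LinearMap.mul' ℂ B (map W.εtL LinearMap.id t) = W.counitLeft (W.Δ 1 * t) := by
    intro t
    induction t using TensorProduct.induction_on with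
    | zero => simp
    | add x y hx hy => simp only [map_add, mul_add, hx, hy]
    | tmul a b =>
      rw [map_tmul, εtL_apply]
      generalize W.Δ 1 = z
      induction z using TensorProduct.induction_on with
      | zero => simp
      | add x y hx hy =>
        simp only [map_add, add_mul, LinearMap.mul'_apply] at hx hy ⊢
        rw [hx, hy]
      | tmul c d => simp
  rw [h, comul_one_mul_comul, counitLeft_comul]

lemma mul_map_id_εsL_comul (x : B) : LinearMap.mul' ℂ B (map LinearMap.id W.εsL (W.Δ x)) = x := by
  have h : ∀ t : B ⊗[ℂ] B,
      LinearMap.mul' ℂ B (map LinearMap.id W.εsL t) = W.counitRight (t * W.Δ 1) := by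
    intro t
    induction t using TensorProduct.induction_on with
    | zero => simp
    | add x y hx hy => simp only [map_add, add_mul, hx, hy]
    | tmul a b =>
      rw [map_tmul, εsL_apply]
      generalize W.Δ 1 = z
      induction z using TensorProduct.induction_on with
      | zero => simp
      | add x y hx hy =>
        simp only [map_add, mul_add, LinearMap.mul'_apply] at hx hy ⊢
        rw [hx, hy]
      | tmul c d => simp
  rw [h, comul_mul_comul_one, counitRight_comul]

lemma mul_map_εsL_S_comul (x : B) : LinearMap.mul' ℂ B (map W.εsL W.S (W.Δ x)) = W.S x := by
  have h : ∀ t : B ⊗[ℂ] B, LinearMap.mul' ℂ B (map LinearMap.id W.S (((1 : B) ⊗ₜ[ℂ] x) * t)) =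
      LinearMap.mul' ℂ B (map LinearMap.id W.S t) * W.S x := by
    intro t
    induction t using TensorProduct.induction_on with
    | zero => simp
    | add x y hx hy => simp only [map_add, mul_add, add_mul, hx, hy]
    | tmul a b => simp [W.antipode_mul, mul_assoc]
  have h2 : map W.εsL W.S (W.Δ x) = map LinearMap.id W.S (map W.εsL LinearMap.id (W.Δ x)) := by
    conv_rhs => rw [← LinearMap.comp_apply, ← map_comp]
    rfl
  rw [h2, map_εsL_id_comul, h, antipode_left', εtL_one, one_mul]

lemma counit_εsL (x : B) : W.ε (W.εsL x) = W.ε x := by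
  have h : ∀ t : B ⊗[ℂ] B,
      W.ε (W.counitRight (((1 : B) ⊗ₜ[ℂ] x) * t)) = W.ε (x * W.counitLeft t) := by
    intro t
    induction t using TensorProduct.induction_on with
    | zero => simp
    | add x y hx hy => simp only [map_add, mul_add, hx, hy]
    | tmul a b => simp [mul_comm]
  rw [εsL_apply, h, counitLeft_comul, mul_one]

end WHA

namespace WHA

variable {B : Type} [NormedRing B] [StarRing B] [CStarRing B] [NormedAlgebra ℂ B]
  [StarModule ℂ B] [FiniteDimensional ℂ B] (W : WHA B)

lemma map_comul_mul {n : Type*} [Fintype n] (M N : Matrix n n B) :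
    (M * N).map W.Δ = M.map W.Δ * N.map W.Δ := by
  ext i j
  simp [Matrix.mul_apply, W.comul_mul]

/-- The antipode of a unitary corepresentation is its adjoint. -/
lemma map_antipode_eq_star {n : Type*} [Fintype n] [DecidableEq n] (U : Matrix n n B)
    (hΔ : ∀ i j, W.Δ (U i j) = ∑ k, U i k ⊗ₜ[ℂ] U k j)
    (hε : ∀ i j, W.ε (U i j) = (1 : Matrix n n ℂ) i j) (hU : U * star U * U = U) :
    U.map W.S = star U := by
  let ι₁ : Matrix n n B →+* Matrix n n (B ⊗[ℂ] B) :=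
    (Algebra.TensorProduct.includeLeft : B →ₐ[ℂ] B ⊗[ℂ] B).toRingHom.mapMatrix
  let ι₂ : Matrix n n B →+* Matrix n n (B ⊗[ℂ] B) :=
    (Algebra.TensorProduct.includeRight : B →ₐ[ℂ] B ⊗[ℂ] B).toRingHom.mapMatrix
  let D : Matrix n n B → Matrix n n (B ⊗[ℂ] B) := fun M => M.map W.Δ
  let z : Matrix n n (B ⊗[ℂ] B) := Matrix.diagonal fun _ => W.Δ 1
  have ι₁_apply : ∀ M i j, ι₁ M i j = M i j ⊗ₜ[ℂ] 1 := fun _ _ _ => rfl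
  have ι₂_apply : ∀ M i j, ι₂ M i j = 1 ⊗ₜ[ℂ] M i j := fun _ _ _ => rfl
  have D_mul : ∀ M N, D (M * N) = D M * D N := W.map_comul_mul
  have D_star : ∀ M, D (star M) = star (D M) := fun M => by
    ext i j : 2
    exact W.comul_star' _
  have ι₁_star : ∀ M, ι₁ (star M) = star (ι₁ M) := fun M => by
    ext i j : 2
    simp [ι₁_apply, Matrix.star_apply]
  have ι₂_star : ∀ M, ι₂ (star M) = star (ι₂ M) := fun M => by
    ext i j : 2
    simp [ι₂_apply, Matrix.star_apply]
  have z_mul_D : ∀ M, z * D M = D M := fun M => by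
    ext i j : 2
    simp only [z, Matrix.diagonal_mul]
    exact W.comul_one_mul_comul _
  have D_mul_z : ∀ M, D M * z = D M := fun M => by
    ext i j : 2
    simp only [z, Matrix.mul_diagonal]
    exact W.comul_mul_comul_one _
  let V := U.map W.S
  let E := U.map W.εtL
  let F := U.map W.εsL
  have hE : E = U * V := by
    ext i j
    simp only [E, V, Matrix.map_apply, Matrix.mul_apply, ← W.antipode_left', hΔ, map_sum, map_tmul,
      LinearMap.mul'_apply, LinearMap.id_apply]
  have hF : F = V * U := by
    ext i j
    simp only [F, V, Matrix.map_apply, Matrix.mul_apply, ← W.antipode_right', hΔ, map_sum, map_tmul,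
      LinearMap.mul'_apply, LinearMap.id_apply]
  have hEU : E * U = U := by
    ext i j
    rw [← W.mul_map_εtL_id_comul (U i j), hΔ]
    simp [E, Matrix.mul_apply]
  have hUF : U * F = U := by
    ext i j
    rw [← W.mul_map_id_εsL_comul (U i j), hΔ]
    simp [F, Matrix.mul_apply]
  have hFV : F * V = V := by
    ext i j
    simp only [V, Matrix.map_apply]
    rw [← W.mul_map_εsL_S_comul (U i j), hΔ]
    simp [F, Matrix.mul_apply]
  have hUs : star U * U * star U = star U := by
    simpa [mul_assoc] using congrArg star hU
  let P := U * star U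
  let Q := star U * U
  let a := ι₁ U
  let b := ι₂ U
  have hDU : D U = a * b := by
    ext i j : 2
    simp [D, a, b, hΔ, Matrix.mul_apply, ι₁_apply, ι₂_apply]
  have hp : ι₂ P = b * star b := by rw [map_mul, ι₂_star]
  have hq : ι₁ Q = star a * a := by rw [map_mul, ι₁_star]
  have hDP : D P = D U * star (D U) := by rw [D_mul, D_star]
  have hDQ : D Q = star (D U) * D U := by rw [D_mul, D_star]
  have haq : a * ι₁ Q = a := by rw [← map_mul, ← mul_assoc, hU]
  have hpb : ι₂ P * b = b := by rw [← map_mul, hU]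
  have hqq : ι₁ Q * ι₁ Q = ι₁ Q := by
    rw [← map_mul, ← mul_assoc, hUs]
  have hpp : ι₂ P * ι₂ P = ι₂ P := by
    rw [← map_mul, ← mul_assoc, hU]
  have hps : star (ι₂ P) = ι₂ P := by rw [hp, star_mul, star_star]
  have hqs : star (ι₁ Q) = ι₁ Q := by rw [hq, star_mul, star_star]
  have hqpqp : ι₁ Q * ι₂ P * ι₁ Q * ι₂ P = ι₁ Q * ι₂ P := by
    have h := congrArg D hU
    rw [D_mul, D_mul, D_star, hDU] at h
    have h' := congrArg (fun x => star a * x * star b) h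
    rw [hp, hq]
    simpa only [star_mul, mul_assoc] using h'
  have hqp : ι₁ Q * ι₂ P = ι₂ P * ι₁ Q * ι₂ P := by
    rw [← sub_eq_zero]
    apply Matrix.tensor_eq_zero_of_star_mul_self
    have hq' : ∀ x, ι₁ Q * (ι₁ Q * x) = ι₁ Q * x := fun x => by rw [← mul_assoc, hqq]
    have hp' : ∀ x, ι₂ P * (ι₂ P * x) = ι₂ P * x := fun x => by rw [← mul_assoc, hpp]
    simp only [mul_assoc] at hqpqp
    simp only [star_sub, star_mul, hps, hqs, mul_sub, sub_mul, mul_assoc, hq', hp', hqpqp,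
      sub_self]
  have hcomm : ι₁ Q * ι₂ P = ι₂ P * ι₁ Q := by
    have h := congrArg star hqp
    rw [star_mul, star_mul, star_mul, hps, hqs, ← mul_assoc] at h
    exact hqp.trans h.symm
  have hPE : P = E := by
    have h1 : a * ι₂ E = z * a := by
      ext i j : 2
      simp only [z, Matrix.diagonal_mul, a, ι₁_apply]
      rw [← W.map_id_εtL_comul, hΔ]
      simp [Matrix.mul_apply, ι₁_apply, ι₂_apply, E]
    have h2 : a * ι₂ P = D P * a := by
      calc a * ι₂ P = a * (ι₂ P * ι₁ Q) := by rw [← hcomm, ← mul_assoc, haq]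
        _ = D P * a := by rw [hDP, hDU, hp, hq, star_mul]; simp only [mul_assoc]
    have h3 : D E = z * ι₁ E := by
      ext i j : 2
      simp only [z, Matrix.diagonal_mul]
      exact W.comul_εtL _
    have h4 : D P * D E = D E := by
      rw [← D_mul, hE, ← mul_assoc, hU]
    have h5 : ι₁ E * a = a := by rw [← map_mul, hEU]
    have h6 : D P * a = z * a := by
      rw [← h5, ← mul_assoc, ← mul_assoc, ← h3, ← h4, h3, ← mul_assoc, D_mul_z]
    have h7 : a * ι₂ P = a * ι₂ E := by rw [h2, h6, h1]
    have h8 : ∀ M i j, W.counitLeft ((a * ι₂ M) i j) = M i j := fun M i j => by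
      simp [Matrix.mul_apply, a, ι₁_apply, ι₂_apply, hε, Matrix.one_apply]
    ext i j
    rw [← h8 P, h7, h8]
  have hQF : Q = F := by
    have h1 : ι₁ F * b = b * z := by
      ext i j : 2
      simp only [z, Matrix.mul_diagonal, b, ι₂_apply]
      rw [← W.map_εsL_id_comul, hΔ]
      simp [Matrix.mul_apply, ι₁_apply, ι₂_apply, F]
    have h2 : ι₁ Q * b = b * D Q := by
      calc ι₁ Q * b = ι₂ P * ι₁ Q * b := by rw [← hcomm, mul_assoc, hpb]
        _ = b * D Q := by rw [hDQ, hDU, hp, hq, star_mul]; simp only [mul_assoc]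
    have h3 : D F = ι₂ F * z := by
      ext i j : 2
      simp only [z, Matrix.mul_diagonal]
      exact W.comul_εsL _
    have h4 : D F * D Q = D F := by
      rw [← D_mul, hF, mul_assoc, ← mul_assoc U, hU]
    have h5 : b * ι₂ F = b := by rw [← map_mul, hUF]
    have h6 : b * D F = b * z := by rw [h3, ← mul_assoc, h5]
    have h7 : ι₁ Q * b = ι₁ F * b := by
      rw [h2, h1, ← z_mul_D, ← mul_assoc, ← h6, mul_assoc, h4]
    have h8 : ∀ M i j, W.counitRight ((ι₁ M * b) i j) = M i j := fun M i j => by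
      simp [Matrix.mul_apply, b, ι₁_apply, ι₂_apply, hε, Matrix.one_apply]
    ext i j
    rw [← h8 Q, h7, h8]
  change V = star U
  rw [← hFV, ← hQF, mul_assoc, ← hE, ← hPE, ← mul_assoc, hUs]

end WHA

namespace WHA

variable {B : Type} [NormedRing B] [StarRing B] [CStarRing B] [NormedAlgebra ℂ B]
  [StarModule ℂ B] [FiniteDimensional ℂ B] (W : WHA B)

/-- The conjugate-linear multiplicative map `b ↦ S(b)*`. -/
def starAntipode : B →ₛₗ[starRingEnd ℂ] B := (starLinearEquiv ℂ : B ≃ₗ⋆[ℂ] B).toLinearMap.comp W.S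

lemma starAntipode_apply (b : B) : W.starAntipode b = star (W.S b) := rfl

lemma starAntipode_mul (a b : B) :
    W.starAntipode (a * b) = W.starAntipode a * W.starAntipode b := by
  simp [starAntipode_apply, W.antipode_mul]

@[simp] lemma starAntipode_one : W.starAntipode 1 = 1 := by
  simp [starAntipode_apply, W.antipode_one]

/-- The map `a ⊗ b ↦ S(b)* ⊗ S(a)*`. -/
def starAntipodeFlip (t : B ⊗[ℂ] B) : B ⊗[ℂ] B :=
  star (map W.S W.S (TensorProduct.comm ℂ B B t))

@[simp] lemma starAntipodeFlip_zero : W.starAntipodeFlip 0 = 0 := by simp [starAntipodeFlip]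

lemma starAntipodeFlip_add (s t : B ⊗[ℂ] B) :
    W.starAntipodeFlip (s + t) = W.starAntipodeFlip s + W.starAntipodeFlip t := by
  simp [starAntipodeFlip]

@[simp] lemma starAntipodeFlip_tmul (a b : B) :
    W.starAntipodeFlip (a ⊗ₜ b) = W.starAntipode b ⊗ₜ W.starAntipode a := by
  simp [starAntipodeFlip, starAntipode_apply]

lemma comul_starAntipode (b : B) : W.Δ (W.starAntipode b) = W.starAntipodeFlip (W.Δ b) := by
  rw [starAntipode_apply, W.comul_star', W.antipode_comul, starAntipodeFlip]

lemma starAntipodeFlip_mul (s t : B ⊗[ℂ] B) :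
    W.starAntipodeFlip (s * t) = W.starAntipodeFlip s * W.starAntipodeFlip t := by
  induction s using TensorProduct.induction_on with
  | zero => simp
  | add x y hx hy => simp only [add_mul, starAntipodeFlip_add, hx, hy]
  | tmul a b =>
    induction t using TensorProduct.induction_on with
    | zero => simp
    | add x y hx hy => simp only [mul_add, starAntipodeFlip_add, hx, hy]
    | tmul c d => simp [starAntipode_mul]

lemma starAntipodeFlip_comul_one : W.starAntipodeFlip (W.Δ 1) = W.Δ 1 := by
  rw [← comul_starAntipode, starAntipode_one]

lemma εsL_starAntipode {z : B} (h : W.εtL z = z) :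
    W.εsL (W.starAntipode z) = W.starAntipode z := by
  apply W.εsL_eq_of_comul
  have := W.comul_εtL' z
  rw [h] at this
  rw [comul_starAntipode, this, starAntipodeFlip_mul, starAntipodeFlip_comul_one]
  simp

lemma εtL_starAntipode {z : B} (h : W.εsL z = z) :
    W.εtL (W.starAntipode z) = W.starAntipode z := by
  apply W.εtL_eq_of_comul
  have := W.comul_εsL' z
  rw [h] at this
  rw [comul_starAntipode, this, starAntipodeFlip_mul, starAntipodeFlip_comul_one]
  simp

/-- The map `φ ⊗ id`. -/
def sliceLeft {A A' : Type} [Ring A] [Algebra ℂ A] [Ring A'] [Algebra ℂ A']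
    (φ : Module.Dual ℂ A) : A ⊗[ℂ] A' →ₗ[ℂ] A' :=
  (TensorProduct.lid ℂ A').toLinearMap ∘ₗ map φ LinearMap.id

@[simp] lemma sliceLeft_tmul {A A' : Type} [Ring A] [Algebra ℂ A] [Ring A'] [Algebra ℂ A']
    (φ : Module.Dual ℂ A) (a : A) (b : A') : sliceLeft φ (a ⊗ₜ[ℂ] b) = φ a • b := by
  simp [sliceLeft]

/-- The involution `φ*(b) = conj φ(S(b)*)` of the dual. -/
def dualStar (φ : Module.Dual ℂ B) : Module.Dual ℂ B :=
  (starLinearEquiv ℂ : ℂ ≃ₗ⋆[ℂ] ℂ).toLinearMap.comp (φ.comp W.starAntipode)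

lemma dualStar_apply (φ : Module.Dual ℂ B) (b : B) :
    W.dualStar φ b = star (φ (W.starAntipode b)) := rfl

/-- `ψ` is a right integral: `(ψ ⊗ id)Δ` takes values in the range of `ε_s`. -/
def IsRightIntegral (ψ : Module.Dual ℂ B) : Prop :=
  ∀ c : B, W.εsL (sliceLeft ψ (W.Δ c)) = sliceLeft ψ (W.Δ c)

lemma isLeftIntegral_iff (φ : Module.Dual ℂ B) : IsLeftIntegral W φ ↔ ∀ c : B,
    W.εtL (TensorProduct.rid ℂ B (map LinearMap.id φ (W.Δ c))) =
      TensorProduct.rid ℂ B (map LinearMap.id φ (W.Δ c)) := by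
  refine forall_congr' fun c => ?_
  rw [eq_comm]
  have : ∀ t : B ⊗[ℂ] B, TensorProduct.rid ℂ B (map W.εtL φ t) =
      W.εtL (TensorProduct.rid ℂ B (map LinearMap.id φ t)) := by
    intro t
    induction t using TensorProduct.induction_on with
    | zero => simp
    | add x y hx hy => simp only [map_add, hx, hy]
    | tmul a b => simp
  rw [this]

lemma dualStar_dualStar (hT : ∀ b, W.starAntipode (W.starAntipode b) = b)
    (φ : Module.Dual ℂ B) : W.dualStar (W.dualStar φ) = φ := by
  ext b
  simp [dualStar_apply, hT]

lemma sliceLeft_dualStar_comul (hT : ∀ b, W.starAntipode (W.starAntipode b) = b)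
    (φ : Module.Dual ℂ B) (c : B) :
    sliceLeft (W.dualStar φ) (W.Δ (W.starAntipode c)) =
      W.starAntipode (TensorProduct.rid ℂ B (map LinearMap.id φ (W.Δ c))) := by
  rw [comul_starAntipode]
  generalize W.Δ c = t
  induction t using TensorProduct.induction_on with
  | zero => simp
  | add x y hx hy => simp only [map_add, starAntipodeFlip_add, hx, hy]
  | tmul a b => simp [dualStar_apply, hT]

lemma isRightIntegral_dualStar (hT : ∀ b, W.starAntipode (W.starAntipode b) = b)
    {φ : Module.Dual ℂ B} (h : IsLeftIntegral W φ) :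
    W.IsRightIntegral (W.dualStar φ) := by
  intro c
  rw [isLeftIntegral_iff] at h
  rw [← hT c, sliceLeft_dualStar_comul W hT]
  exact W.εsL_starAntipode (h _)

lemma isLeftIntegral_dualStar (hT : ∀ b, W.starAntipode (W.starAntipode b) = b)
    {ψ : Module.Dual ℂ B} (h : W.IsRightIntegral ψ) :
    IsLeftIntegral W (W.dualStar ψ) := by
  rw [isLeftIntegral_iff]
  intro c
  have h1 := sliceLeft_dualStar_comul W hT (W.dualStar ψ) c
  rw [dualStar_dualStar W hT] at h1
  have h2 := W.εtL_starAntipode (h (W.starAntipode c))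
  rwa [h1, hT] at h2

/-- The convolution product of functionals. -/
def conv (x y : Module.Dual ℂ B) : Module.Dual ℂ B := y ∘ₗ sliceLeft x ∘ₗ W.Δ

lemma conv_apply (x y : Module.Dual ℂ B) (b : B) : W.conv x y b = y (sliceLeft x (W.Δ b)) := rfl

lemma conv_εsL_eq_zero {y : Module.Dual ℂ B} (hy : y ∘ₗ W.εsL = 0) (a : Module.Dual ℂ B) :
    W.conv y a ∘ₗ W.εsL = 0 := by
  ext c
  rw [LinearMap.comp_apply, conv_apply, comul_εsL']
  have h := W.map_εsL_id_comul 1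
  rw [← Algebra.TensorProduct.one_def, one_mul] at h
  rw [← h]
  generalize W.Δ 1 = t
  induction t using TensorProduct.induction_on with
  | zero => simp
  | add x y hx hy =>
    simp only [map_add, add_mul, hx, hy]
    simp
  | tmul p q =>
    have : y (W.εsL p) = 0 := LinearMap.congr_fun hy p
    simp [this]

/-- A weak Hopf `*`-algebra spanned by the coefficients of a unitary corepresentation has a
normalised right integral. -/
lemma exists_isRightIntegral {N : Type} [Fintype N] (v : Matrix N N B)
    (hv : Submodule.span ℂ (Set.range fun p : N × N => v p.1 p.2) = ⊤)
    (hΔ : ∀ i j, W.Δ (v i j) = ∑ k, v i k ⊗ₜ[ℂ] v k j)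
    (hS : ∀ i j, W.starAntipode (v i j) = v j i) :
    ∃ l : Module.Dual ℂ B, W.IsRightIntegral l ∧ ∀ c, l (W.εsL c) = W.ε c := by
  let Φ : Module.Dual ℂ B →ₗ[ℂ] EuclideanSpace ℂ (N × N) :=
    { toFun := fun x => WithLp.toLp 2 fun p => x (v p.1 p.2)
      map_add' := fun x y => rfl
      map_smul' := fun c x => rfl }
  have Φ_apply : ∀ x p, Φ x p = x (v p.1 p.2) := fun _ _ => rfl
  have Φ_inj : ∀ x, Φ x = 0 → x = 0 := by
    intro x hx
    refine LinearMap.ext_on hv ?_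
    rintro _ ⟨p, rfl⟩
    exact congrArg (fun w : EuclideanSpace ℂ (N × N) => w p) hx
  have hinner : ∀ x y, inner ℂ (Φ x) (Φ y) = ∑ i, ∑ j, star (x (v i j)) * y (v i j) := by
    intro x y
    rw [PiLp.inner_apply, Fintype.sum_prod_type]
    simp [Φ_apply, mul_comm]
  have hconv : ∀ x y i j, W.conv x y (v i j) = ∑ k, x (v i k) * y (v k j) := by
    intro x y i j
    simp [conv_apply, hΔ]
  let J : Submodule ℂ (Module.Dual ℂ B) := LinearMap.ker W.εsL.dualMap
  have conv_mem : ∀ {y}, y ∈ J → ∀ a, W.conv y a ∈ J := fun hy => W.conv_εsL_eq_zero hy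
  obtain ⟨e, heJ, he⟩ : ∃ e ∈ J, ∀ y ∈ J, inner ℂ (Φ y) (Φ (W.ε - e)) = 0 := by
    obtain ⟨e, he, he'⟩ := Submodule.mem_map.1 ((J.map Φ).starProjection_apply_mem (Φ W.ε))
    refine ⟨e, he, fun y hy => ?_⟩
    rw [map_sub, he']
    exact Submodule.sub_starProjection_mem_orthogonal (K := J.map Φ) (Φ W.ε) _
      (Submodule.mem_map_of_mem hy)
  have hadj : ∀ x y, inner ℂ (Φ y) (Φ (W.conv (W.ε - e) x)) =
      inner ℂ (Φ (W.conv y (W.dualStar x))) (Φ (W.ε - e)) := by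
    intro x y
    simp only [hinner, hconv, dualStar_apply, hS, star_sum, star_mul', star_star,
      Finset.sum_mul, Finset.mul_sum]
    refine Finset.sum_congr rfl fun i _ => ?_
    rw [Finset.sum_comm]
    refine Finset.sum_congr rfl fun j _ => Finset.sum_congr rfl fun k _ => ?_
    ring
  have hker : ∀ x ∈ J, W.conv (W.ε - e) x = 0 := by
    intro x hx
    have hmem : W.conv (W.ε - e) x ∈ J := by
      have : W.conv (W.ε - e) x = x - W.conv e x := by
        ext c
        have h : ∀ t : B ⊗[ℂ] B, sliceLeft (W.ε - e) t = W.counitLeft t - sliceLeft e t := by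
          intro t
          induction t using TensorProduct.induction_on with
          | zero => simp
          | add x y hx hy => simp only [map_add, hx, hy]; abel
          | tmul a b => simp [sub_smul]
        simp [conv_apply, h]
      rw [this]
      exact J.sub_mem hx (conv_mem heJ x)
    apply Φ_inj
    rw [← inner_self_eq_zero (𝕜 := ℂ), hadj]
    exact he _ (conv_mem hmem _)
  refine ⟨W.ε - e, fun c => ?_, fun c => ?_⟩
  · rw [← sub_eq_zero, ← Module.forall_dual_apply_eq_zero_iff ℂ]
    intro a
    have hx : a - a ∘ₗ W.εsL ∈ J := by
      change (a - a ∘ₗ W.εsL) ∘ₗ W.εsL = 0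
      ext b
      simp [εsL_εsL]
    have := LinearMap.congr_fun (hker _ hx) c
    simp only [conv_apply, LinearMap.sub_apply, LinearMap.comp_apply, LinearMap.zero_apply] at this
    rw [map_sub, ← neg_sub, this, neg_zero]
  · have h : e (W.εsL c) = 0 := LinearMap.congr_fun heJ c
    rw [LinearMap.sub_apply, h, sub_zero, counit_εsL]

end WHA
section Corepresentation

variable {B : Type} [NormedRing B] [StarRing B] [CStarRing B] [NormedAlgebra ℂ B]
  [StarModule ℂ B] [FiniteDimensional ℂ B] {W : WHA B}

namespace UCorep

variable {n : ℕ} (V : UCorep W (EuclideanSpace ℂ (Fin n)))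

lemma starAntipode_coefMatrix (i j : Fin n) :
    W.starAntipode (V.coefMatrix i j) = V.coefMatrix j i := by
  have h := congrFun₂ (W.map_antipode_eq_star V.coefMatrix V.comul_coefMatrix V.counit_coefMatrix
    V.coefMatrix_mul_star_mul_self) i j
  rw [Matrix.map_apply, Matrix.star_apply] at h
  rw [WHA.starAntipode_apply, h, star_star]

lemma matCoef_zero_left (η : EuclideanSpace ℂ (Fin n)) : V.matCoef 0 η = 0 := by
  simp [matCoef_eq_sum]

lemma matCoef_add_left (ζ ζ' η : EuclideanSpace ℂ (Fin n)) :
    V.matCoef (ζ + ζ') η = V.matCoef ζ η + V.matCoef ζ' η := by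
  simp [matCoef_eq_sum, add_mul, add_smul, Finset.sum_add_distrib]

lemma matCoef_smul_left (c : ℂ) (ζ η : EuclideanSpace ℂ (Fin n)) :
    V.matCoef (c • ζ) η = star c • V.matCoef ζ η := by
  simp [matCoef_eq_sum, Finset.smul_sum, smul_smul, mul_assoc]

lemma matCoef_dualAct (φ : Module.Dual ℂ B) (ξ η : EuclideanSpace ℂ (Fin n)) :
    V.matCoef (V.dualAct φ ξ) η = WHA.sliceLeft (W.dualStar φ) (W.Δ (V.matCoef ξ η)) := by
  simp only [matCoef_eq_sum, dualAct_apply, map_sum, map_smul, comul_coefMatrix,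
    WHA.sliceLeft_tmul, WHA.dualStar_apply, starAntipode_coefMatrix, star_sum, star_mul',
    Finset.sum_mul, Finset.sum_smul, Finset.smul_sum, smul_smul]
  rw [Finset.sum_comm, Finset.sum_congr rfl fun j _ => Finset.sum_comm, Finset.sum_comm]
  refine Finset.sum_congr rfl fun i _ => Finset.sum_congr rfl fun j _ =>
    Finset.sum_congr rfl fun k _ => ?_
  congr 1
  ring

end UCorep

/-- `B` is spanned by the matrix entries of its unitary corepresentations on some `ℂⁿ`. -/
lemma span_coefMatrix_eq_top (hspan : Submodule.span ℂ
      {b : B | ∃ (n : ℕ) (V : UCorep W (EuclideanSpace ℂ (Fin n)))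
        (η ζ : EuclideanSpace ℂ (Fin n)), b = V.matCoef η ζ} = ⊤) :
    Submodule.span ℂ {b : B | ∃ (n : ℕ) (V : UCorep W (EuclideanSpace ℂ (Fin n)))
        (i j : Fin n), b = V.coefMatrix i j} = ⊤ := by
  rw [eq_top_iff, ← hspan, Submodule.span_le]
  rintro _ ⟨n, V, η, ζ, rfl⟩
  rw [UCorep.matCoef_eq_sum]
  exact Submodule.sum_mem _ fun i _ => Submodule.sum_mem _ fun j _ =>
    Submodule.smul_mem _ _ (Submodule.subset_span ⟨n, V, i, j, rfl⟩)

/-- `B` is spanned by the matrix entries of a single corepresentation, given by a matrix whose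
antipode is its adjoint. -/
lemma exists_generating_matrix (hspan : Submodule.span ℂ
      {b : B | ∃ (n : ℕ) (V : UCorep W (EuclideanSpace ℂ (Fin n)))
        (η ζ : EuclideanSpace ℂ (Fin n)), b = V.matCoef η ζ} = ⊤) :
    ∃ (N : Type) (_ : Fintype N) (v : Matrix N N B),
      Submodule.span ℂ (Set.range fun p : N × N => v p.1 p.2) = ⊤ ∧
      (∀ i j, W.Δ (v i j) = ∑ k, v i k ⊗ₜ[ℂ] v k j) ∧
      ∀ i j, W.starAntipode (v i j) = v j i := by
  classical
  obtain ⟨b, hb, hbspan, hli⟩ := exists_linearIndependent ℂ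
    {b : B | ∃ (n : ℕ) (V : UCorep W (EuclideanSpace ℂ (Fin n)))
      (i j : Fin n), b = V.coefMatrix i j}
  rw [span_coefMatrix_eq_top hspan] at hbspan
  have : Finite b := hli.finite
  have : Fintype b := Fintype.ofFinite b
  choose n V i j hV using fun x : b => hb x.2
  let v := Matrix.blockDiagonal' fun x : b => (V x).coefMatrix
  have hne : ∀ x y : b, x ≠ y → ∀ i j, v ⟨x, i⟩ ⟨y, j⟩ = 0 := fun x y hxy i j =>
    Matrix.blockDiagonal'_apply_ne _ _ _ hxy
  have heq : ∀ (x : b) (i j : Fin (n x)), v ⟨x, i⟩ ⟨x, j⟩ = (V x).coefMatrix i j := fun x i j =>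
    Matrix.blockDiagonal'_apply_eq _ _ _ _
  refine ⟨Σ x : b, Fin (n x), inferInstance, v, ?_, ?_, ?_⟩
  · rw [eq_top_iff, ← hbspan, Submodule.span_le]
    intro x hx
    refine Submodule.subset_span ⟨(⟨⟨x, hx⟩, i ⟨x, hx⟩⟩, ⟨⟨x, hx⟩, j ⟨x, hx⟩⟩), ?_⟩
    simp only [heq]
    exact (hV ⟨x, hx⟩).symm
  · rintro ⟨x, i⟩ ⟨y, j⟩
    rw [Fintype.sum_sigma, Finset.sum_eq_single x]
    · obtain rfl | hxy := eq_or_ne x y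
      · simp only [heq, UCorep.comul_coefMatrix]
      · simp [hne x y hxy]
    · intro z _ hz
      simp [hne x z hz.symm]
    · simp
  · rintro ⟨x, i⟩ ⟨y, j⟩
    obtain rfl | hxy := eq_or_ne x y
    · simp only [heq, UCorep.starAntipode_coefMatrix]
    · simp [hne x y hxy, hne y x hxy.symm]

namespace WHAHom

variable {C : Type} [NormedRing C] [StarRing C] [CStarRing C]
    [NormedAlgebra ℂ C] [StarModule ℂ C] [FiniteDimensional ℂ C] {W' : WHA C} (h : WHAHom W W')

lemma starAntipode_comp (b : B) : W'.starAntipode (h.π b) = h.π (W.starAntipode b) := by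
  rw [WHA.starAntipode_apply, h.antipode_comp, WHA.starAntipode_apply, map_star]

lemma εsL_comp (b : B) : W'.εsL (h.π b) = h.π (W.εsL b) := by
  rw [WHA.εsL_apply, WHA.εsL_apply, ← map_one h.π, h.comul_comp]
  generalize W.Δ 1 = t
  induction t using TensorProduct.induction_on with
  | zero => simp
  | add x y hx hy => simp only [map_add, mul_add, hx, hy]
  | tmul c d =>
    have := h.counit_comp (b * d)
    rw [map_mul] at this
    simp [this]

lemma dualStar_comp (φ : Module.Dual ℂ C) :
    W.dualStar (h.π.toLinearMap.dualMap φ) = h.π.toLinearMap.dualMap (W'.dualStar φ) := by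
  ext b
  simp [WHA.dualStar_apply, starAntipode_comp]

lemma sliceLeft_map (φ : Module.Dual ℂ C) (t : B ⊗[ℂ] B) :
    WHA.sliceLeft φ (map h.π.toLinearMap LinearMap.id t) =
      WHA.sliceLeft (h.π.toLinearMap.dualMap φ) t := by
  induction t using TensorProduct.induction_on with
  | zero => simp
  | add x y hx hy => simp only [map_add, hx, hy]
  | tmul c d => simp

lemma map_sliceLeft_comul (φ : Module.Dual ℂ C) (b : B) :
    h.π (WHA.sliceLeft (h.π.toLinearMap.dualMap φ) (W.Δ b)) =
      WHA.sliceLeft φ (W'.Δ (h.π b)) := by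
  rw [h.comul_comp]
  generalize W.Δ b = t
  induction t using TensorProduct.induction_on with
  | zero => simp
  | add x y hx hy => simp only [map_add, hx, hy]
  | tmul c d => simp

end WHAHom

lemma WHA.comul_sliceLeft_comul (W : WHA B) (χ : Module.Dual ℂ B) (b : B) :
    W.Δ (WHA.sliceLeft χ (W.Δ b)) = map (WHA.sliceLeft χ ∘ₗ W.Δ) LinearMap.id (W.Δ b) := by
  have h : ∀ t : B ⊗[ℂ] B,
      W.Δ (WHA.sliceLeft χ t) = map (WHA.sliceLeft χ) LinearMap.id (W.comulSnd t) := by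
    intro t
    induction t using TensorProduct.induction_on with
    | zero => simp
    | add x y hx hy => simp only [map_add, hx, hy]
    | tmul c d =>
      simp only [WHA.comulSnd, LinearMap.comp_apply, map_tmul, LinearMap.id_apply,
        WHA.sliceLeft_tmul, map_smul]
      generalize W.Δ d = s
      induction s using TensorProduct.induction_on with
      | zero => simp
      | add x y hx hy => simp only [map_add, tmul_add, smul_add, hx, hy]
      | tmul c d => simp [smul_tmul']
  rw [h, W.comulSnd_comul, WHA.comulFst, ← LinearMap.comp_apply, ← map_comp, LinearMap.id_comp]

section Quotient

variable {C : Type} [NormedRing C] [StarRing C] [CStarRing C]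
    [NormedAlgebra ℂ C] [StarModule ℂ C] [FiniteDimensional ℂ C] {W' : WHA C} (h : WHAHom W W')

/-- The quotient type coideal as a subspace. -/
def quotientCoidealSubmodule : Submodule ℂ B :=
  LinearMap.eqLocus (map h.π.toLinearMap LinearMap.id ∘ₗ W.Δ)
    (map h.π.toLinearMap LinearMap.id ∘ₗ LinearMap.mulRight ℂ (W.Δ 1) ∘ₗ TensorProduct.mk ℂ B B 1)

lemma coe_quotientCoidealSubmodule :
    (quotientCoidealSubmodule h : Set B) = quotientCoideal W W' h := rfl

lemma mem_quotientCoidealSubmodule {b : B} : b ∈ quotientCoidealSubmodule h ↔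
    map h.π.toLinearMap LinearMap.id (W.Δ b) =
      map h.π.toLinearMap LinearMap.id (((1 : B) ⊗ₜ[ℂ] b) * W.Δ 1) := Iff.rfl

lemma sliceLeft_mem_quotientCoidealSubmodule {ψ : Module.Dual ℂ C} (hψ : W'.IsRightIntegral ψ)
    (x : B) :
    WHA.sliceLeft (h.π.toLinearMap.dualMap ψ) (W.Δ x) ∈ quotientCoidealSubmodule h := by
  rw [mem_quotientCoidealSubmodule, ← W.map_εsL_id_comul, W.comul_sliceLeft_comul]
  generalize W.Δ x = t
  induction t using TensorProduct.induction_on with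
  | zero => simp
  | add x y hx hy => simp only [map_add, hx, hy]
  | tmul a b =>
    have := hψ (h.π a)
    rw [← h.map_sliceLeft_comul, h.εsL_comp] at this
    exact congrArg (· ⊗ₜ[ℂ] b) this.symm

lemma sliceLeft_comul_eq_self {l : Module.Dual ℂ C} (hl : ∀ c, l (W'.εsL c) = W'.ε c) {b : B}
    (hb : b ∈ quotientCoidealSubmodule h) :
    WHA.sliceLeft (h.π.toLinearMap.dualMap l) (W.Δ b) = b := by
  have h1 : WHA.sliceLeft (h.π.toLinearMap.dualMap l) (W.Δ 1) = 1 := by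
    have h2 := W.map_εsL_id_comul 1
    rw [← Algebra.TensorProduct.one_def, one_mul] at h2
    have h3 : ∀ t : B ⊗[ℂ] B, WHA.sliceLeft (h.π.toLinearMap.dualMap l)
        (map W.εsL LinearMap.id t) = W.counitLeft t := by
      intro t
      induction t using TensorProduct.induction_on with
      | zero => simp
      | add x y hx hy => simp only [map_add, hx, hy]
      | tmul c d =>
        have := hl (h.π c)
        rw [h.εsL_comp, h.counit_comp] at this
        simp [this]
    rw [← h2, h3, W.counitLeft_comul]
  have h4 : ∀ t : B ⊗[ℂ] B, WHA.sliceLeft (h.π.toLinearMap.dualMap l) (((1 : B) ⊗ₜ[ℂ] b) * t) =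
      b * WHA.sliceLeft (h.π.toLinearMap.dualMap l) t := by
    intro t
    induction t using TensorProduct.induction_on with
    | zero => simp
    | add x y hx hy => simp only [map_add, mul_add, hx, hy]
    | tmul c d => simp
  rw [← h.sliceLeft_map, (mem_quotientCoidealSubmodule h).1 hb, h.sliceLeft_map, h4, h1, mul_one]

end Quotient

end Corepresentation

theorem quotientCoideal_eq_span_matCoef {B C : Type} [NormedRing B] [StarRing B] [CStarRing B]
    [NormedAlgebra ℂ B] [StarModule ℂ B] [FiniteDimensional ℂ B]
    [NormedRing C] [StarRing C] [CStarRing C] [NormedAlgebra ℂ C] [StarModule ℂ C]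
    [FiniteDimensional ℂ C] (W : WHA B) (W' : WHA C) (h : WHAHom W W')
    (hsurj : Function.Surjective h.π)
    -- `B` is linearly spanned by matrix coefficients of its unitary corepresentations
    (hspan : Submodule.span ℂ
      {b : B | ∃ (n : ℕ) (V : UCorep W (EuclideanSpace ℂ (Fin n)))
        (η ζ : EuclideanSpace ℂ (Fin n)), b = V.matCoef η ζ} = ⊤) :
    quotientCoideal W W' h =
      ↑(Submodule.span ℂ
        {b : B | ∃ (n : ℕ) (V : UCorep W (EuclideanSpace ℂ (Fin n)))
          (η ζ : EuclideanSpace ℂ (Fin n)),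
          ζ ∈ Submodule.span ℂ
            {v : EuclideanSpace ℂ (Fin n) | ∃ φ : Module.Dual ℂ C, IsLeftIntegral W' φ ∧
              ∃ ξ : EuclideanSpace ℂ (Fin n), v = V.dualAct (h.π.toLinearMap.dualMap φ) ξ} ∧
          b = V.matCoef ζ η}) := by
  obtain ⟨N, _, v, hv, hvΔ, hvS⟩ := exists_generating_matrix hspan
  have hTB : ∀ b, W.starAntipode (W.starAntipode b) = b := by
    intro b
    have hb : b ∈ Submodule.span ℂ (Set.range fun p : N × N => v p.1 p.2) := hv ▸ trivial
    induction hb using Submodule.span_induction with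
    | mem x hx =>
      obtain ⟨p, rfl⟩ := hx
      simp only [hvS]
    | zero => simp
    | add x y _ _ hx hy => rw [map_add, map_add, hx, hy]
    | smul c x _ hx => simp [hx]
  have hTC : ∀ c, W'.starAntipode (W'.starAntipode c) = c := by
    intro c
    obtain ⟨b, rfl⟩ := hsurj c
    rw [h.starAntipode_comp, h.starAntipode_comp, hTB]
  obtain ⟨l, hl, hlε⟩ := W'.exists_isRightIntegral (v.map h.π)
    (by
      have := congrArg (Submodule.map h.π.toLinearMap) hv
      rw [Submodule.map_span, Submodule.map_top, LinearMap.range_eq_top.2 hsurj,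
        ← Set.range_comp] at this
      exact this)
    (fun i j => by simp [h.comul_comp, hvΔ])
    (fun i j => by simp [h.starAntipode_comp, hvS])
  rw [← coe_quotientCoidealSubmodule]
  refine congrArg _ (le_antisymm (fun b hb => ?_) (Submodule.span_le.2 ?_))
  · rw [← sliceLeft_comul_eq_self h hlε hb]
    have hb' : b ∈ Submodule.span ℂ {b : B | ∃ (n : ℕ) (V : UCorep W (EuclideanSpace ℂ (Fin n)))
        (η ζ : EuclideanSpace ℂ (Fin n)), b = V.matCoef η ζ} := hspan ▸ trivial
    clear hb
    induction hb' using Submodule.span_induction with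
    | mem x hx =>
      obtain ⟨n, V, η, ζ, rfl⟩ := hx
      refine Submodule.subset_span ⟨n, V, ζ, _, Submodule.subset_span
        ⟨W'.dualStar l, W'.isLeftIntegral_dualStar hTC hl, η, rfl⟩, ?_⟩
      rw [V.matCoef_dualAct, h.dualStar_comp, W'.dualStar_dualStar hTC]
    | zero => simp
    | add x y _ _ hx hy =>
      rw [map_add, map_add]
      exact Submodule.add_mem _ hx hy
    | smul c x _ hx =>
      rw [map_smul, map_smul]
      exact Submodule.smul_mem _ _ hx
  · rintro _ ⟨n, V, η, ζ, hζ, rfl⟩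
    induction hζ using Submodule.span_induction with
    | mem x hx =>
      obtain ⟨φ, hφ, ξ, rfl⟩ := hx
      rw [V.matCoef_dualAct, h.dualStar_comp]
      exact sliceLeft_mem_quotientCoidealSubmodule h (W'.isRightIntegral_dualStar hTC hφ) _
    | zero =>
      rw [V.matCoef_zero_left]
      exact Submodule.zero_mem _
    | add x y _ _ hx hy =>
      rw [V.matCoef_add_left]
      exact Submodule.add_mem _ hx hy
    | smul c x _ hx =>
      rw [V.matCoef_smul_left]
      exact Submodule.smul_mem _ _ hx

end
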